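/- arXiv:2509.23485 — 3 statements merged into one kernel-verified Lean document; each statement's English description precedes it below -/
import Mathlib

section
/- Let p be a prime number, let A be a commutative ring of characteristic p, and let B be an étale A-algebra. Let A_F denote the ring A regarded as an A-algebra via the Frobenius endomorphism x ↦ xᵖ of A. Then the relative Frobenius homomorphism B ⊗_A A_F → B, determined by b ⊗ a ↦ bᵖ·a, is an isomorphism of A_F-algebras. -/
/-!
STATEMENT 3: For an étale algebra `B` over a commutative ring `A` of characteristic `p`,
the relative Frobenius `B ⊗[A] A_F → B`, `b ⊗ a ↦ bᵖ · a`, is an isomorphism of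
`A_F`-algebras, where `A_F` is `A` viewed as an `A`-algebra via the Frobenius `x ↦ xᵖ`.

We state the existence of a ring isomorphism satisfying the defining formula
`e (b ⊗ₜ a) = bᵖ * algebraMap A B a`; this formula in particular makes `e` a morphism of
`A_F`-algebras (the `A_F`-algebra structure map of `B ⊗[A] A_F` is `a ↦ 1 ⊗ₜ a`, and that of
`B` is the original `algebraMap A B`).
-/

universe u

open TensorProduct

/-- `AFrob p A` is the ring `A`, regarded as an `A`-algebra via the Frobenius `x ↦ xᵖ`. -/
def AFrob (p : ℕ) (A : Type u) [CommRing A] : Type u := A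

instance (p : ℕ) (A : Type u) [CommRing A] : CommRing (AFrob p A) :=
  inferInstanceAs (CommRing A)

/-- The `A`-algebra structure on `AFrob p A` is given by the Frobenius endomorphism. -/
instance (p : ℕ) (A : Type u) [CommRing A] [Fact p.Prime] [CharP A p] :
    Algebra A (AFrob p A) :=
  (frobenius A p).toAlgebra

theorem RelFrob.sub_pow {R : Type*} [CommRing R] {p : ℕ} (hp : p.Prime) (h : (p : R) = 0)
    (x y : R) : (x - y) ^ p = x ^ p - y ^ p := by
  rcases subsingleton_or_nontrivial R with _ | _
  · exact Subsingleton.elim _ _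
  · have : Fact p.Prime := ⟨hp⟩
    have : CharP R p := (CharP.charP_iff_prime_eq_zero hp).2 h
    exact sub_pow_char x y

theorem RelFrob.add_pow {R : Type*} [CommRing R] {p : ℕ} (hp : p.Prime) (h : (p : R) = 0)
    (x y : R) : (x + y) ^ p = x ^ p + y ^ p := by
  rcases subsingleton_or_nontrivial R with _ | _
  · exact Subsingleton.elim _ _
  · have : Fact p.Prime := ⟨hp⟩
    have : CharP R p := (CharP.charP_iff_prime_eq_zero hp).2 h
    exact add_pow_char x y p

/-- Étale algebras `D` over `C` with `D ^ p` in the image of `C` and nil kernel are trivial. -/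
theorem RelFrob.bijective {C D : Type*} [CommRing C] [CommRing D] [Algebra C D]
    [Algebra.Etale C D] {p : ℕ} (hp : p.Prime) (h : (p : C) = 0)
    (h1 : ∀ d : D, ∃ c : C, algebraMap C D c = d ^ p)
    (h2 : ∀ c : C, algebraMap C D c = 0 → IsNilpotent c) :
    Function.Bijective (algebraMap C D) := by
  have hint : Algebra.IsIntegral C D := ⟨fun d ↦ by
    obtain ⟨c, hc⟩ := h1 d
    exact IsIntegral.of_pow hp.pos (hc ▸ isIntegral_algebraMap)⟩
  have hfin : Module.Finite C D := Algebra.IsIntegral.finite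
  have hT : (p : D ⊗[C] D) = 0 := by
    rw [← map_natCast (algebraMap C (D ⊗[C] D)), h, map_zero]
  obtain ⟨t, ht, ht1⟩ := (Algebra.FormallyUnramified.iff_exists_tensorProduct (R := C)
    (S := D)).1 inferInstance
  have hle : KaehlerDifferential.ideal C D ≤ nilradical (D ⊗[C] D) := by
    rw [← KaehlerDifferential.span_range_eq_ideal, Ideal.span_le]
    rintro _ ⟨s, rfl⟩
    refine ⟨p, ?_⟩
    obtain ⟨c, hc⟩ := h1 s
    change _ = (0 : D ⊗[C] D)
    simp only [RelFrob.sub_pow hp hT, Algebra.TensorProduct.tmul_pow, one_pow, ← hc]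
    rw [sub_eq_zero, Algebra.algebraMap_eq_smul_one, TensorProduct.tmul_smul,
      TensorProduct.smul_tmul']
  have hnil : IsNilpotent (1 - t) := hle (by
    simp [KaehlerDifferential.ideal, RingHom.mem_ker, ht1])
  have hunit : IsUnit t := by simpa using hnil.isUnit_one_sub
  have hepi : Algebra.IsEpi C D := (Algebra.isEpi_iff_forall_one_tmul_eq C D).2 fun s ↦
    sub_eq_zero.1 (hunit.mul_left_eq_zero.1 (ht s))
  have hsurj : Function.Surjective (algebraMap C D) :=
    Algebra.isEpi_iff_surjective_algebraMap_of_finite.1 hepi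
  refine ⟨?_, hsurj⟩
  have hid := (Algebra.FormallyEtale.iff_of_surjective hsurj).1 inferInstance
  have hfg : (RingHom.ker (algebraMap C D)).FG :=
    Algebra.FinitePresentation.ker_fG_of_surjective (Algebra.ofId C D) hsurj
  obtain ⟨e, he, hk⟩ := (Ideal.isIdempotentElem_iff_of_fg _ hfg).1 hid
  have he0 : e = 0 := by
    obtain ⟨n, hn⟩ := h2 e (by
      rw [← RingHom.mem_ker, hk]; exact Ideal.mem_span_singleton_self e)
    rcases Nat.eq_zero_or_pos n with rfl | hpos
    · rw [pow_zero] at hn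
      rw [← mul_one e, hn, mul_zero]
    · rwa [he.pow_eq (by lia)] at hn
  rw [RingHom.injective_iff_ker_eq_bot, hk, he0]
  simp

/-- `B` with the Frobenius-twisted `A`-algebra structure. -/
def BFrob (p : ℕ) (A B : Type u) [CommRing A] [CommRing B] [Algebra A B] : Type u := B

instance (p : ℕ) (A B : Type u) [CommRing A] [CommRing B] [Algebra A B] :
    CommRing (BFrob p A B) :=
  inferInstanceAs (CommRing B)

instance (p : ℕ) (A B : Type u) [CommRing A] [CommRing B] [Algebra A B] :
    Algebra (AFrob p A) (BFrob p A B) :=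
  inferInstanceAs (Algebra A B)

instance (p : ℕ) (A B : Type u) [CommRing A] [CommRing B] [Algebra A B]
    [Fact p.Prime] [CharP A p] : Algebra A (BFrob p A B) :=
  ((algebraMap (AFrob p A) (BFrob p A B)).comp (algebraMap A (AFrob p A))).toAlgebra

instance (p : ℕ) (A B : Type u) [CommRing A] [CommRing B] [Algebra A B]
    [Fact p.Prime] [CharP A p] : IsScalarTower A (AFrob p A) (BFrob p A B) :=
  IsScalarTower.of_algebraMap_eq' rfl

instance (p : ℕ) (A B : Type u) [CommRing A] [CommRing B] [Algebra A B]
    [h : Algebra.Etale A B] : Algebra.Etale (AFrob p A) (BFrob p A B) := h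

/-- The `p`-th power map. -/
def RelFrob.powHom (p : ℕ) [Fact p.Prime] (A B : Type u) [CommRing A] [CommRing B]
    [CharP A p] [Algebra A B] : B →ₐ[A] BFrob p A B where
  toFun b := (b ^ p : B)
  map_one' := one_pow (M := B) p
  map_zero' := zero_pow (M₀ := B) (Fact.out : p.Prime).ne_zero
  map_mul' x y := mul_pow (M := B) x y p
  map_add' x y := RelFrob.add_pow (R := B) Fact.out
    (by rw [← map_natCast (algebraMap A B), CharP.cast_eq_zero, map_zero]) x y
  commutes' a := (map_pow (algebraMap A B) a p).symm

/-- The relative Frobenius. -/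
noncomputable def RelFrob.rel (p : ℕ) [Fact p.Prime] (A B : Type u) [CommRing A] [CommRing B]
    [CharP A p] [Algebra A B] : (AFrob p A ⊗[A] B) →ₐ[AFrob p A] BFrob p A B :=
  Algebra.TensorProduct.lift (Algebra.ofId _ _) (RelFrob.powHom p A B) fun _ _ ↦ .all _ _

/-- The identity, with codomain `B`. -/
def RelFrob.toB (p : ℕ) (A B : Type u) [CommRing A] [CommRing B] [Algebra A B] :
    BFrob p A B →+* B := RingHom.id B

theorem RelFrob.toB_rel (p : ℕ) [Fact p.Prime] (A B : Type u) [CommRing A] [CommRing B]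
    [CharP A p] [Algebra A B] (a : A) (b : B) :
    RelFrob.toB p A B (RelFrob.rel p A B ((show AFrob p A from a) ⊗ₜ[A] b)) =
      algebraMap A B a * b ^ p := by
  have h : RelFrob.rel p A B ((show AFrob p A from a) ⊗ₜ[A] b) =
      Algebra.ofId (AFrob p A) (BFrob p A B) a * RelFrob.powHom p A B b :=
    Algebra.TensorProduct.lift_tmul _ _ _ _ _
  rw [h, map_mul]
  rfl

theorem RelFrob.rel_bijective (p : ℕ) [Fact p.Prime] (A B : Type u) [CommRing A] [CommRing B]
    [CharP A p] [Algebra A B] [Algebra.Etale A B] :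
    Function.Bijective (RelFrob.rel p A B) := by
  have hp : p.Prime := Fact.out
  let : Algebra (AFrob p A ⊗[A] B) (BFrob p A B) := (RelFrob.rel p A B).toRingHom.toAlgebra
  have : IsScalarTower (AFrob p A) (AFrob p A ⊗[A] B) (BFrob p A B) :=
    IsScalarTower.of_algebraMap_eq' (RelFrob.rel p A B).comp_algebraMap.symm
  have : Algebra.Etale (AFrob p A ⊗[A] B) (BFrob p A B) :=
    Algebra.Etale.of_restrictScalars (AFrob p A) _ _
  have h0 : (p : AFrob p A ⊗[A] B) = 0 := by
    rw [← map_natCast (algebraMap A (AFrob p A ⊗[A] B)), CharP.cast_eq_zero, map_zero]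
  have key : ∀ c : AFrob p A ⊗[A] B,
      (1 : AFrob p A) ⊗ₜ[A] RelFrob.toB p A B (RelFrob.rel p A B c) = c ^ p := by
    intro c
    induction c with
    | zero =>
      rw [map_zero, map_zero, zero_pow hp.ne_zero, TensorProduct.tmul_zero]
    | add x y hx hy =>
      rw [RelFrob.add_pow hp h0, ← hx, ← hy, map_add, map_add, TensorProduct.tmul_add]
    | tmul a b =>
      have e1 : RelFrob.toB p A B (RelFrob.rel p A B (a ⊗ₜ b)) = (show A from a) • b ^ p := by
        rw [Algebra.smul_def]
        exact RelFrob.toB_rel p A B a b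
      rw [e1, TensorProduct.tmul_smul, TensorProduct.smul_tmul', Algebra.TensorProduct.tmul_pow,
        Algebra.smul_def, mul_one]
      rfl
  refine RelFrob.bijective (C := AFrob p A ⊗[A] B) (D := BFrob p A B) hp h0 (fun d ↦ ?_)
    (fun c hc ↦ ?_)
  · refine ⟨(1 : AFrob p A) ⊗ₜ[A] (d : B), ?_⟩
    have := RelFrob.toB_rel p A B 1 d
    rw [map_one, one_mul] at this
    exact this
  · refine ⟨p, ?_⟩
    rw [← key c]
    have : (RelFrob.rel p A B c) = 0 := hc
    rw [this, map_zero, TensorProduct.tmul_zero]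

theorem statement3 (p : ℕ) [Fact p.Prime] (A B : Type u) [CommRing A] [CommRing B]
    [CharP A p] [Algebra A B] [Algebra.Etale A B] :
    ∃ e : (B ⊗[A] AFrob p A) ≃+* B,
      ∀ (b : B) (a : A), e (b ⊗ₜ[A] (a : AFrob p A)) = b ^ p * algebraMap A B a := by
  refine ⟨((Algebra.TensorProduct.comm A B (AFrob p A)).toRingEquiv).trans
    (RingEquiv.ofBijective (RelFrob.rel p A B) (RelFrob.rel_bijective p A B)), fun b a ↦ ?_⟩
  refine (RelFrob.toB_rel p A B a b).trans ?_
  exact mul_comm (algebraMap A B a) (b ^ p)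
end

section
/- Let p be a prime number, let A be a commutative ring of characteristic p, and let B₀ be an étale A-algebra. Then the base change B₀ ⊗_A (PerfectClosure A p) is a perfect ring, and the unique B₀-algebra homomorphism PerfectClosure B₀ p → B₀ ⊗_A (PerfectClosure A p) (obtained from the universal property of the perfect closure of B₀) is an isomorphism. -/
/-!
STATEMENT 5: Let `A` be a commutative ring of characteristic `p` and `B₀` an étale
`A`-algebra. Then `B₀ ⊗[A] PerfectClosure A p` is a perfect ring (its Frobenius `x ↦ xᵖ`
is bijective), and the unique `B₀`-algebra homomorphism
`PerfectClosure B₀ p → B₀ ⊗[A] PerfectClosure A p` obtained from the universal property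
of the perfect closure (applied to the structure map `b ↦ b ⊗ 1`) is an isomorphism.
-/

universe u

open TensorProduct

/-- The canonical algebra structure of a ring of characteristic `p` on its perfect closure,
given by the canonical ring homomorphism `PerfectClosure.of`. -/
noncomputable instance (p : ℕ) [Fact p.Prime] (A : Type u) [CommRing A] [CharP A p] :
    Algebra A (PerfectClosure A p) :=
  (PerfectClosure.of A p).toAlgebra

set_option linter.style.haveILetI false

/-- An étale algebra all of whose elements have `p`-th power in the image of the base, and
such that the structure map has nil kernel, is trivial. -/
theorem etale_radicial_bijective (p : ℕ) [Fact p.Prime] (C D : Type u) [CommRing C] [CommRing D]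
    [Algebra C D] [Algebra.Etale C D] (hpD : (p : D) = 0)
    (h1 : ∀ x : D, ∃ c, algebraMap C D c = x ^ p)
    (h2 : ∀ c : C, algebraMap C D c = 0 → IsNilpotent c) :
    Function.Bijective (algebraMap C D) := by
  have hp0 : p ≠ 0 := (Fact.out : p.Prime).ne_zero
  have hpT : (p : D ⊗[C] D) = 0 := by
    have := congrArg (Algebra.TensorProduct.includeLeftRingHom : D →+* D ⊗[C] D) hpD
    simpa using this
  have key : ∀ s : D, IsNilpotent ((1 : D) ⊗ₜ[C] s - s ⊗ₜ[C] (1 : D)) := by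
    intro s
    refine ⟨p, ?_⟩
    obtain ⟨c, hc⟩ := h1 s
    rcases subsingleton_or_nontrivial (D ⊗[C] D) with hs | hn
    · exact Subsingleton.elim _ _
    have : CharP (D ⊗[C] D) p := (CharP.charP_iff_prime_eq_zero Fact.out).2 hpT
    rw [sub_pow_char, Algebra.TensorProduct.tmul_pow, Algebra.TensorProduct.tmul_pow, one_pow,
      ← hc, Algebra.algebraMap_eq_smul_one, TensorProduct.tmul_smul, TensorProduct.smul_tmul',
      sub_self]
  have hepi : Algebra.IsEpi C D := by
    rw [Algebra.isEpi_iff_forall_one_tmul_eq]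
    intro s
    obtain ⟨t, ht, ht1⟩ := (Algebra.FormallyUnramified.iff_exists_tensorProduct (R := C) (S := D)).1
      inferInstance
    have hmem : (1 : D ⊗[C] D) - t ∈ KaehlerDifferential.ideal C D := by
      rw [KaehlerDifferential.ideal, RingHom.mem_ker]
      simp [ht1]
    have hle : KaehlerDifferential.ideal C D ≤ nilradical (D ⊗[C] D) := by
      rw [← KaehlerDifferential.span_range_eq_ideal, Ideal.span_le]
      rintro _ ⟨s, rfl⟩
      exact key s
    have hu : IsUnit t := by
      have := IsNilpotent.isUnit_one_sub (mem_nilradical.1 (hle hmem))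
      simpa using this
    rw [← sub_eq_zero]
    exact hu.mul_left_eq_zero.1 (ht s)
  have hint : Algebra.IsIntegral C D := ⟨fun x => by
    obtain ⟨c, hc⟩ := h1 x
    refine IsIntegral.of_pow (Nat.pos_of_ne_zero hp0) ?_
    rw [← hc]
    exact isIntegral_algebraMap⟩
  have hfin : Module.Finite C D := Algebra.IsIntegral.finite
  have hsurj : Function.Surjective (algebraMap C D) :=
    Algebra.isEpi_iff_surjective_algebraMap_of_finite.1 hepi
  refine ⟨?_, hsurj⟩
  have hid := (Algebra.FormallyEtale.iff_of_surjective hsurj).1 inferInstance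
  have hfg : (RingHom.ker (algebraMap C D)).FG :=
    Algebra.FinitePresentation.ker_fG_of_surjective (Algebra.ofId C D) hsurj
  obtain ⟨e, he, hspan⟩ := (Ideal.isIdempotentElem_iff_of_fg _ hfg).1 hid
  have hemem : e ∈ RingHom.ker (algebraMap C D) := by
    rw [hspan]; exact Ideal.mem_span_singleton_self e
  obtain ⟨n, hn⟩ := h2 e hemem
  have he0 : e = 0 := by
    have h3 := he.pow_succ_eq n
    rw [pow_succ, hn, zero_mul] at h3
    exact h3.symm
  rw [RingHom.injective_iff_ker_eq_bot, hspan, he0]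
  simp

/-- An étale algebra over a perfect ring is perfect. -/
theorem etale_perfect (p : ℕ) [Fact p.Prime] (P C : Type u) [CommRing P] [CharP P p]
    [PerfectRing P p] [CommRing C] [CharP C p] [Algebra P C] [Algebra.Etale P C] :
    Function.Bijective (frobenius C p) := by
  have hcomp : ((frobenius C p).comp (algebraMap P C)).Etale := by
    have : (frobenius C p).comp (algebraMap P C) = (algebraMap P C).comp (frobenius P p) := by
      ext x; simp [frobenius_def]
    rw [this]
    exact RingHom.Etale.stableUnderComposition _ _
      (RingHom.Etale.of_bijective (bijective_frobenius P p))
      ((RingHom.etale_algebraMap).2 inferInstance)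
  have hF : (frobenius C p).Etale := by
    have aux : ∀ (D : Type u) [CommRing D] (f : C →+* D), (f.comp (algebraMap P C)).Etale →
        f.Etale := by
      intro D _ f hf
      letI : Algebra C D := f.toAlgebra
      letI : Algebra P D := (f.comp (algebraMap P C)).toAlgebra
      haveI : IsScalarTower P C D := IsScalarTower.of_algebraMap_eq' rfl
      haveI : Algebra.Etale P D := hf
      exact Algebra.Etale.of_restrictScalars P C D
    exact aux C _ hcomp
  have aux : ∀ (D : Type u) [CommRing D] (f : C →+* D), f.Etale → (p : D) = 0 →
      (∀ x : D, ∃ c, f c = x ^ p) → (∀ c, f c = 0 → IsNilpotent c) → Function.Bijective f := by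
    intro D _ f hf h0 h1 h2
    letI : Algebra C D := f.toAlgebra
    haveI : Algebra.Etale C D := hf
    exact etale_radicial_bijective p C D h0 h1 h2
  exact aux C _ hF (CharP.cast_eq_zero C p) (fun x => ⟨x, rfl⟩) (fun c hc => ⟨p, hc⟩)

/-- The comparison map from the base change to the perfect closure. -/
theorem exists_toPerfectClosure (p : ℕ) [Fact p.Prime] (A : Type u) [CommRing A] [CharP A p]
    (B₀ : Type u) [CommRing B₀] [Algebra A B₀] [CharP B₀ p] :
    ∃ g : B₀ ⊗[A] PerfectClosure A p →+* PerfectClosure B₀ p,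
      ∀ b : B₀, g (b ⊗ₜ 1) = PerfectClosure.of B₀ p b := by
  letI : Algebra A (PerfectClosure B₀ p) :=
    ((PerfectClosure.of B₀ p).comp (algebraMap A B₀)).toAlgebra
  let f₁ : B₀ →ₐ[A] PerfectClosure B₀ p := ⟨PerfectClosure.of B₀ p, fun _ => rfl⟩
  let f₂ : PerfectClosure A p →ₐ[A] PerfectClosure B₀ p :=
    ⟨PerfectClosure.lift A p _ ((PerfectClosure.of B₀ p).comp (algebraMap A B₀)), fun _ => rfl⟩
  refine ⟨(Algebra.TensorProduct.lift f₁ f₂ (fun _ _ => Commute.all _ _)).toRingHom, fun b => ?_⟩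
  simp [f₁]

theorem statement5 (p : ℕ) [Fact p.Prime] (A : Type u) [CommRing A] [CharP A p]
    (B₀ : Type u) [CommRing B₀] [Algebra A B₀] [CharP B₀ p] [Algebra.Etale A B₀] :
    Function.Bijective (fun x : B₀ ⊗[A] PerfectClosure A p => x ^ p) ∧
    ∀ hc : CharP (B₀ ⊗[A] PerfectClosure A p) p,
      haveI := hc
      ∀ hp : PerfectRing (B₀ ⊗[A] PerfectClosure A p) p,
        haveI := hp
        Function.Bijective
          (PerfectClosure.lift B₀ p (B₀ ⊗[A] PerfectClosure A p)
            Algebra.TensorProduct.includeLeftRingHom) := by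
  obtain ⟨g, hg⟩ := exists_toPerfectClosure p A B₀
  refine ⟨?_, ?_⟩
  · haveI : Nontrivial (PerfectClosure B₀ p) :=
      CharP.nontrivial_of_char_ne_one (Fact.out : p.Prime).ne_one
    haveI : Nontrivial (B₀ ⊗[A] PerfectClosure A p) := g.domain_nontrivial
    haveI : CharP (B₀ ⊗[A] PerfectClosure A p) p := by
      refine (CharP.charP_iff_prime_eq_zero Fact.out).2 ?_
      have := congrArg (Algebra.TensorProduct.includeLeftRingHom :
        B₀ →+* B₀ ⊗[A] PerfectClosure A p) (CharP.cast_eq_zero B₀ p)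
      rwa [map_natCast, map_zero] at this
    letI : Algebra (PerfectClosure A p) (B₀ ⊗[A] PerfectClosure A p) :=
      Algebra.TensorProduct.rightAlgebra
    haveI : Algebra.Etale (PerfectClosure A p) (B₀ ⊗[A] PerfectClosure A p) :=
      Algebra.Etale.of_equiv (A := PerfectClosure A p ⊗[A] B₀)
        { Algebra.TensorProduct.comm A (PerfectClosure A p) B₀ with
          commutes' := fun r => by
            simp [Algebra.TensorProduct.right_algebraMap_apply] }
    exact etale_perfect p (PerfectClosure A p) (B₀ ⊗[A] PerfectClosure A p)
  · intro hc hp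
    set L := PerfectClosure.lift B₀ p (B₀ ⊗[A] PerfectClosure A p)
            Algebra.TensorProduct.includeLeftRingHom with hL
    have hLof : ∀ b, L (PerfectClosure.of B₀ p b) = b ⊗ₜ 1 := fun b => rfl
    constructor
    · have : g.comp L = RingHom.id _ := by
        apply (PerfectClosure.lift B₀ p (PerfectClosure B₀ p)).symm.injective
        ext b
        change g (L (PerfectClosure.of B₀ p b)) = _
        rw [hLof, hg]
        rfl
      exact Function.LeftInverse.injective (g := g) (fun x => RingHom.congr_fun this x)
    · intro x
      change x ∈ L.range
      induction x with
      | zero => exact zero_mem _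
      | add x y hx hy => exact add_mem hx hy
      | tmul b y =>
        have hb : b ⊗ₜ[A] y = (b ⊗ₜ[A] (1 : PerfectClosure A p)) * ((1 : B₀) ⊗ₜ[A] y) := by simp
        rw [hb]
        refine mul_mem ⟨_, hLof b⟩ ?_
        obtain ⟨⟨n, a⟩, rfl⟩ := PerfectClosure.mk_surjective A p y
        refine ⟨PerfectClosure.mk B₀ p (n, algebraMap A B₀ a), ?_⟩
        apply (injective_frobenius (B₀ ⊗[A] PerfectClosure A p) p).iterate n
        rw [← L.map_iterate_frobenius, PerfectClosure.iterate_frobenius_mk, hLof]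
        have h3 := (Algebra.TensorProduct.includeRight :
          PerfectClosure A p →ₐ[A] B₀ ⊗[A] PerfectClosure A p).toRingHom.map_iterate_frobenius p
            (PerfectClosure.mk A p (n, a)) n
        rw [PerfectClosure.iterate_frobenius_mk] at h3
        refine Eq.trans ?_ h3
        change _ = (1 : B₀) ⊗ₜ[A] (algebraMap A (PerfectClosure A p) a)
        rw [Algebra.algebraMap_eq_smul_one, Algebra.algebraMap_eq_smul_one,
          TensorProduct.tmul_smul, TensorProduct.smul_tmul']
end

section
/- Let A be a Noetherian commutative ring and let B be an étale A-algebra that is Noetherian. Say a Noetherian commutative ring R satisfies Serre's condition S₂ if for every prime ideal 𝔮 of R, the depth of the local ring R_𝔮 is at least the minimum of 2 and the height of 𝔮. If A satisfies S₂, then B satisfies S₂. Conversely, if the induced map Spec B → Spec A is surjective and B satisfies S₂, then A satisfies S₂. -/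
/-!
STATEMENT 11: Serre's condition S₂ is étale-local: if `B` is an étale `A`-algebra
(`A`, `B` Noetherian) and `A` satisfies S₂, then so does `B`; conversely if
`Spec B → Spec A` is surjective and `B` satisfies S₂, then so does `A`.

Here a Noetherian ring `R` satisfies S₂ if for every prime `𝔮` of `R` the depth of the
local ring `R_𝔮` is at least `min 2 (height 𝔮)`, where the depth of a Noetherian local
ring is the length of a maximal regular sequence contained in the maximal ideal, and the
height of `𝔮` is the Krull dimension of the localization at `𝔮`.
-/

universe u

/-- The depth of a local ring: the supremum of the lengths of regular sequences contained
in the maximal ideal. -/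
noncomputable def ringDepth (R : Type u) [CommRing R] [IsLocalRing R] : ℕ∞ :=
  sSup {n : ℕ∞ | ∃ rs : List R, (rs.length : ℕ∞) = n ∧
    (∀ r ∈ rs, r ∈ IsLocalRing.maximalIdeal R) ∧ RingTheory.Sequence.IsRegular R rs}

/-- A Noetherian commutative ring `R` satisfies Serre's condition `S₂` if for every prime
ideal `𝔮` of `R`, the depth of the local ring `R_𝔮` is at least the minimum of `2` and
the height of `𝔮` (the height being the Krull dimension of the localization at `𝔮`). -/
def SerreS2 (R : Type u) [CommRing R] : Prop :=
  ∀ (q : Ideal R) (hq : q.IsPrime),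
    haveI := hq
    min 2 (ringKrullDim (Localization.AtPrime q)) ≤
      (ringDepth (Localization.AtPrime q) : WithBot ℕ∞)

open RingTheory.Sequence CategoryTheory Abelian IsLocalRing TensorProduct

/-- Cutting by a regular element drops depth by exactly one. -/
theorem exists_isRegular_quotSMulTop {R : Type u} [CommRing R] [IsNoetherianRing R]
    [IsLocalRing R] (M : Type u) [AddCommGroup M] [Module R M] [Module.Finite R M]
    (r : R) (hr : r ∈ maximalIdeal R) (hreg : IsSMulRegular M r) (n : ℕ)
    (h : ∃ rs : List R, rs.length = n + 1 ∧ (∀ r ∈ rs, r ∈ maximalIdeal R) ∧ IsRegular M rs) :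
    ∃ rs : List R, rs.length = n ∧ (∀ r ∈ rs, r ∈ maximalIdeal R) ∧
      IsRegular (QuotSMulTop r M) rs := by
  have hM : Nontrivial M := by
    obtain ⟨rs, -, -, h⟩ := h
    exact h.nontrivial
  have hQ : Nontrivial (QuotSMulTop r M) := nontrivial_quotSMulTop_of_mem_maximalIdeal M hr
  have lt (N : Type u) [AddCommGroup N] [Module R N] [Module.Finite R N] [Nontrivial N] :
      maximalIdeal R • (⊤ : Submodule R N) < ⊤ :=
    (Submodule.top_ne_ideal_smul_of_le_jacobson_annihilator
      (maximalIdeal_le_jacobson _)).symm.lt_top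
  have e := ((ModuleCat.exists_isRegular_tfae (maximalIdeal R) (n + 1) (ModuleCat.of R M)
    (lt M)).out 1 3).mpr h
  refine ((ModuleCat.exists_isRegular_tfae (maximalIdeal R) n
    (ModuleCat.of R (QuotSMulTop r M)) (lt _)).out 1 3).mp ?_
  intro i hi
  have zero1 := AddCommGrpCat.isZero_of_iff_subsingleton.mpr (e i (by omega))
  have zero2 := AddCommGrpCat.isZero_of_iff_subsingleton.mpr (e (i + 1) (by omega))
  exact AddCommGrpCat.subsingleton_of_isZero <| ShortComplex.Exact.isZero_of_both_zeros
    ((Ext.covariant_sequence_exact₃' _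
      (IsSMulRegular.smulShortComplex_shortExact (M := ModuleCat.of R M) hreg)) i (i + 1) rfl)
    (zero1.eq_zero_of_src _) (zero2.eq_zero_of_tgt _)

section

variable {R S : Type u} [CommRing R] [CommRing S] [Algebra R S] [IsNoetherianRing R]
  [IsNoetherianRing S] [IsLocalRing R] [IsLocalRing S] [IsLocalHom (algebraMap R S)]
  [Module.Flat R S]

theorem exists_isRegular_descend
    (hm : (maximalIdeal R).map (algebraMap R S) = maximalIdeal S) (n : ℕ)
    (M : Type u) [AddCommGroup M] [Module R M] [Module.Finite R M]
    (N : Type u) [AddCommGroup N] [Module R N] [Module S N] [IsScalarTower R S N]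
    (f : M →ₗ[R] N) (hf : IsBaseChange S f)
    (h : ∃ rs : List S, rs.length = n ∧ (∀ r ∈ rs, r ∈ maximalIdeal S) ∧ IsRegular N rs) :
    ∃ rs : List R, rs.length = n ∧ (∀ r ∈ rs, r ∈ maximalIdeal R) ∧ IsRegular M rs := by
  have ff : Module.FaithfullyFlat R S := Module.FaithfullyFlat.of_flat_of_isLocalHom
  have hN : Nontrivial N := by
    obtain ⟨rs, -, -, h⟩ := h
    exact h.nontrivial
  have hM : Nontrivial M := by
    by_contra hM
    rw [not_nontrivial_iff_subsingleton] at hM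
    have : Subsingleton N := hf.equiv.symm.toEquiv.subsingleton
    exact not_subsingleton N this
  have hfin : Module.Finite S N := Module.Finite.equiv hf.equiv
  have finj : Function.Injective f := by
    have h1 := Module.FaithfullyFlat.tensorProduct_mk_injective (A := R) (B := S) M
    have h2 : ⇑f = hf.equiv ∘ (TensorProduct.mk R S M 1) := by
      ext x
      simp [hf.equiv_tmul]
    rw [h2]
    exact hf.equiv.injective.comp h1
  induction n generalizing M N with
  | zero => exact ⟨[], rfl, by simp, IsRegular.nil R M⟩
  | succ n ih =>
    -- a regular element of `M`
    obtain ⟨r, hr, hreg⟩ : ∃ r ∈ maximalIdeal R, IsSMulRegular M r := by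
      have hs : Subsingleton ((R ⧸ maximalIdeal R) →ₗ[R] M) := by
        refine subsingleton_of_forall_eq 0 fun g ↦ ?_
        obtain ⟨rs, hlen, hmem, hrs⟩ := h
        obtain ⟨a, t, rfl⟩ : ∃ a t, rs = a :: t := by
          cases rs with
          | nil => simp at hlen
          | cons a t => exact ⟨a, t, rfl⟩
        have ha := ((isRegular_cons_iff N a t).mp hrs).1
        have hx : ∀ s ∈ maximalIdeal S, s • f (g 1) = 0 := by
          intro s hs
          rw [← hm] at hs
          have : (maximalIdeal R).map (algebraMap R S) ≤
              (LinearMap.toSpanSingleton S N (f (g 1))).ker := by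
            rw [Ideal.map_le_iff_le_comap]
            intro x hx
            simp only [Ideal.mem_comap, LinearMap.mem_ker, LinearMap.toSpanSingleton_apply,
              algebraMap_smul]
            rw [← map_smul, ← map_smul]
            have : x • (1 : R ⧸ maximalIdeal R) = 0 := by
              rw [← Algebra.algebraMap_eq_smul_one]
              exact Ideal.Quotient.eq_zero_iff_mem.mpr hx
            rw [this, map_zero, map_zero]
          exact this hs
        have h0 : f (g 1) = 0 := by
          apply ha
          simpa using hx a (hmem a (by simp))
        have h1 : g 1 = 0 := finj (by rw [h0, map_zero])
        ext
        simpa using h1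
      obtain ⟨r, hr, hreg⟩ := IsSMulRegular.subsingleton_linearMap_iff.mp hs
      rw [Ideal.annihilator_quotient] at hr
      exact ⟨r, hr, hreg⟩
    have hr' : algebraMap R S r ∈ maximalIdeal S := hm ▸ Ideal.mem_map_of_mem _ hr
    have hregN : IsSMulRegular N (algebraMap R S r) := hreg.of_flat_of_isBaseChange hf
    have hq := exists_isRegular_quotSMulTop N _ hr' hregN n h
    have e := (QuotSMulTop.algebraMapTensorEquivTensorQuotSMulTop r M S).symm ≪≫ₗ
      QuotSMulTop.congr ((algebraMap R S) r) hf.equiv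
    have hg : IsBaseChange S <|
        e.toLinearMap.restrictScalars R ∘ₗ TensorProduct.mk R S (QuotSMulTop r M) 1 :=
      IsBaseChange.of_equiv e (fun _ ↦ by simp)
    have n1 : Nontrivial (QuotSMulTop r M) := nontrivial_quotSMulTop_of_mem_maximalIdeal M hr
    have n2 : Nontrivial (QuotSMulTop (algebraMap R S r) N) :=
      nontrivial_quotSMulTop_of_mem_maximalIdeal N hr'
    obtain ⟨rs, hlen, hmem, hrs⟩ := ih (QuotSMulTop r M) (QuotSMulTop (algebraMap R S r) N)
      _ hg hq n2 n1 inferInstance (by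
        rw [LinearMap.coe_comp]
        exact e.injective.comp
          (Module.FaithfullyFlat.tensorProduct_mk_injective (A := R) (B := S) _))
    refine ⟨r :: rs, by simp [hlen], ?_, hrs.cons hreg⟩
    simpa using ⟨hr, hmem⟩

theorem ringDepth_eq_of_flat
    (hm : (maximalIdeal R).map (algebraMap R S) = maximalIdeal S) :
    ringDepth R = ringDepth S := by
  have ff : Module.FaithfullyFlat R S := Module.FaithfullyFlat.of_flat_of_isLocalHom
  unfold ringDepth
  congr 1
  ext k
  constructor
  · rintro ⟨rs, hlen, hmem, hrs⟩
    refine ⟨rs.map (algebraMap R S), by simpa using hlen, ?_, hrs.of_faithfullyFlat⟩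
    intro s hs
    obtain ⟨r, hr, rfl⟩ := List.mem_map.mp hs
    exact hm ▸ Ideal.mem_map_of_mem _ (hmem r hr)
  · rintro ⟨rs, hlen, hmem, hrs⟩
    obtain ⟨ts, h1, h2, h3⟩ := exists_isRegular_descend hm rs.length R S
      (Algebra.linearMap R S) (IsBaseChange.linearMap R S) ⟨rs, rfl, hmem, hrs⟩
    exact ⟨ts, by rw [h1, hlen], h2, h3⟩

theorem ringKrullDim_eq_of_flat
    (hm : (maximalIdeal R).map (algebraMap R S) = maximalIdeal S) :
    ringKrullDim R = ringKrullDim S := by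
  have hl : (maximalIdeal S).LiesOver (maximalIdeal R) :=
    ⟨(((local_hom_TFAE (algebraMap R S)).out 0 4 rfl rfl).mp ‹_›).symm⟩
  have h := Ideal.height_eq_height_add_of_liesOver_of_hasGoingDown (maximalIdeal R)
    (maximalIdeal S)
  rw [hm, Ideal.map_quotient_self] at h
  have : Nontrivial (S ⧸ maximalIdeal S) := Ideal.Quotient.nontrivial_iff.mpr
    (maximalIdeal.isMaximal S).ne_top
  rw [Ideal.height_bot, add_zero] at h
  rw [← IsLocalRing.maximalIdeal_height_eq_ringKrullDim,
    ← IsLocalRing.maximalIdeal_height_eq_ringKrullDim, h]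

end

theorem serre_local_iff (A B : Type u) [CommRing A] [CommRing B] [Algebra A B]
    [IsNoetherianRing A] [IsNoetherianRing B] [Algebra.Etale A B]
    (p : Ideal A) [p.IsPrime] (q : Ideal B) [q.IsPrime] [q.LiesOver p] :
    ringKrullDim (Localization.AtPrime p) = ringKrullDim (Localization.AtPrime q) ∧
    ringDepth (Localization.AtPrime p) = ringDepth (Localization.AtPrime q) := by
  let := Localization.AtPrime.algebraOfLiesOver p q
  have hflat : Module.Flat A B := inferInstance
  have : Module.Flat (Localization.AtPrime p) (Localization.AtPrime q) := inferInstance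
  have : Algebra.EssFiniteType (Localization.AtPrime p) (Localization.AtPrime q) := .of_comp A _ _
  have : Algebra.FormallyUnramified A (Localization.AtPrime q) := .comp _ B _
  have : Algebra.FormallyUnramified (Localization.AtPrime p) (Localization.AtPrime q) :=
    .of_restrictScalars A _ _
  have hm := Algebra.FormallyUnramified.map_maximalIdeal
    (R := Localization.AtPrime p) (S := Localization.AtPrime q)
  exact ⟨ringKrullDim_eq_of_flat hm, ringDepth_eq_of_flat hm⟩

theorem statement11 (A B : Type u) [CommRing A] [CommRing B] [Algebra A B]
    [IsNoetherianRing A] [IsNoetherianRing B] [Algebra.Etale A B] :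
    (SerreS2 A → SerreS2 B) ∧
    (Function.Surjective (PrimeSpectrum.comap (algebraMap A B)) → SerreS2 B → SerreS2 A) := by
  constructor
  · intro h q hq
    obtain ⟨h1, h2⟩ := serre_local_iff A B (q.under A) q
    have := h (q.under A) inferInstance
    rw [h1, h2] at this
    exact this
  · intro hs h p hp
    obtain ⟨⟨q, hq⟩, hqp⟩ := hs ⟨p, hp⟩
    have : q.LiesOver p := ⟨(congrArg PrimeSpectrum.asIdeal hqp).symm⟩
    obtain ⟨h1, h2⟩ := serre_local_iff A B p q
    have := h q hq
    rw [← h1, ← h2] at this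
    exact this
end
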